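/- Let k ≤ n be positive integers. For every d ≥ 0, the dimension over ℚ of the image of the space of homogeneous polynomials of degree d under the quotient map ℚ[x_1, …, x_n] → R_{n,k} (i.e., the degree-d component of the graded Hilbert series of R_{n,k}, which is well defined since I_{n,k} is a homogeneous ideal) equals the number of surjections f ∈ OP_{n,k} with coinv(f) = d. -/

import Mathlib

open MvPolynomial

/-- The ideal `I_{n,k} ⊆ ℚ[x_1, …, x_n]` generated by `x_1^k, …, x_n^k` together with
the elementary symmetric polynomials `e_d(x_1, …, x_n)` for `n−k+1 ≤ d ≤ n`. -/
noncomputable def Ink (n k : ℕ) : Ideal (MvPolynomial (Fin n) ℚ) :=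
  Ideal.span ({p | ∃ i : Fin n, p = X i ^ k} ∪
    {p | ∃ d : ℕ, n - k + 1 ≤ d ∧ d ≤ n ∧ p = esymm (Fin n) ℚ d})

/-- The inversion number of an ordered set partition, encoded as a function
`f : Fin n → Fin k`: the number of pairs `i < j` with `i` minimal in its block
and `f j < f i`. -/
noncomputable def opInv {n k : ℕ} (f : Fin n → Fin k) : ℕ :=
  Set.ncard {p : Fin n × Fin n |
    p.1 < p.2 ∧ (∀ i' : Fin n, i' < p.1 → f i' ≠ f p.1) ∧ f p.2 < f p.1}

/-- The complementary statistic `coinv(f) = (n−k)(k−1) + k(k−1)/2 − inv(f)`. -/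
noncomputable def opCoinv (n k : ℕ) (f : Fin n → Fin k) : ℕ :=
  (n - k) * (k - 1) + k * (k - 1) / 2 - opInv f

/-- Exponent vectors of the monomials obtained by peeling off one variable at a time: an exponent
`j < k` of the first variable lowers the level `s` by one exactly when `j < s`. -/
def stairs (k : ℕ) : (n : ℕ) → ℕ → Finset (Fin n → ℕ)
  | 0, s => if s = 0 then Finset.univ else ∅
  | n + 1, s =>
    ((Finset.range k).sigma fun j => stairs k n (if j < s then s - 1 else s)).map
      ⟨fun p : (_ : ℕ) × (Fin n → ℕ) => (Fin.cons p.1 p.2 : Fin (n + 1) → ℕ), by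
        rintro ⟨a, f⟩ ⟨b, g⟩ h
        obtain ⟨rfl, rfl⟩ := Fin.cons_inj.1 h
        rfl⟩

open Polynomial in
/-- The degree generating function of `stairs k n s`. -/
noncomputable def stairsPoly (k n s : ℕ) : ℕ[X] :=
  ∑ m ∈ stairs k n s, Polynomial.X ^ (∑ i, m i)

theorem stairsPoly_succ (k n s : ℕ) :
    stairsPoly k (n + 1) s =
      ∑ j ∈ Finset.range k, Polynomial.X ^ j * stairsPoly k n (if j < s then s - 1 else s) := by
  simp only [stairsPoly, stairs, Finset.sum_map, Finset.sum_sigma, Fin.sum_univ_succ, pow_add,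
    Finset.mul_sum]
  rfl

/-- The contribution to `coinv` of a letter placed in block `c`, when `U` is the set of blocks
already opened. -/
def coinvStep {k : ℕ} (U : Finset (Fin k)) (c : Fin k) : ℕ :=
  if c ∈ U then k - 1 - (U.filter (c < ·)).card else (U.filter (· < c)).card

/-- The coinversion statistic of `f` relative to a set `U` of blocks already opened. -/
def coinvRel {k : ℕ} : {n : ℕ} → Finset (Fin k) → (Fin n → Fin k) → ℕ
  | 0, _, _ => 0
  | _ + 1, U, f => coinvStep U (f 0) + coinvRel (insert (f 0) U) (Fin.tail f)

/-- The inversion statistic of `f` relative to a set `U` of blocks already opened. -/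
def invRel {k : ℕ} : {n : ℕ} → Finset (Fin k) → (Fin n → Fin k) → ℕ
  | 0, _, _ => 0
  | _ + 1, U, f => (U.filter (f 0 < ·)).card + invRel (insert (f 0) U) (Fin.tail f)

open Polynomial in
/-- The generating function of `coinvRel U` over the maps hitting every block outside `U`. -/
noncomputable def coinvPoly {k : ℕ} (n : ℕ) (U : Finset (Fin k)) : ℕ[X] :=
  ∑ f : Fin n → Fin k with ∀ c, c ∈ U ∨ ∃ i, f i = c, Polynomial.X ^ coinvRel U f

theorem coinvPoly_succ {k : ℕ} (n : ℕ) (U : Finset (Fin k)) :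
    coinvPoly (n + 1) U =
      ∑ c, Polynomial.X ^ coinvStep U c * coinvPoly n (insert c U) := by
  simp only [coinvPoly, Finset.sum_filter, Finset.mul_sum]
  rw [← (Fin.consEquiv fun _ : Fin (n + 1) => Fin k).sum_comp, Fintype.sum_prod_type]
  refine Finset.sum_congr rfl fun c _ => Finset.sum_congr rfl fun f _ => ?_
  have h : (∀ c', c' ∈ U ∨ ∃ i, (Fin.cons c f : Fin (n + 1) → Fin k) i = c') ↔
      ∀ c', c' ∈ insert c U ∨ ∃ i, f i = c' := by
    refine forall_congr' fun c' => ?_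
    rw [Fin.exists_fin_succ]
    simp only [Fin.cons_zero, Fin.cons_succ, Finset.mem_insert]
    grind
  simp only [Fin.consEquiv_apply, h, coinvRel, Fin.cons_zero, pow_add, mul_ite, mul_zero]
  rfl

theorem sum_card_filter_lt {α M : Type*} [LinearOrder α] [AddCommMonoid M] (U : Finset α)
    (g : ℕ → M) :
    ∑ c ∈ U, g (U.filter (c < ·)).card = ∑ j ∈ Finset.range U.card, g j := by
  induction U using Finset.induction_on_min with
  | empty => simp
  | insert a U ha ih =>
    have ha' : a ∉ U := fun h => lt_irrefl _ (ha a h)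
    rw [Finset.sum_insert ha', Finset.card_insert_of_notMem ha', Finset.sum_range_succ, add_comm,
      ← ih]
    congr 1
    · refine Finset.sum_congr rfl fun c hc => ?_
      rw [Finset.filter_insert, if_neg (ha c hc).not_gt]
    · rw [Finset.filter_insert, if_neg (lt_irrefl a), Finset.filter_true_of_mem ha]

/-- The number of pairs `u < c` with `u ∈ U` and `c ∉ U`. -/
def crossings {k : ℕ} (U : Finset (Fin k)) : ℕ :=
  ∑ c ∈ Uᶜ, (U.filter (· < c)).card

theorem crossings_insert {k : ℕ} (U : Finset (Fin k)) {c : Fin k} (hc : c ∉ U) :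
    (U.filter (· < c)).card + crossings (insert c U) =
      crossings U + (Uᶜ.filter (c < ·)).card := by
  have h : Uᶜ = insert c (insert c U)ᶜ := by
    ext x; simp; grind
  have h1 : crossings U = (U.filter (· < c)).card + ∑ x ∈ (insert c U)ᶜ, (U.filter (· < x)).card := by
    unfold crossings
    rw [h, Finset.sum_insert (by simp)]
  have h2 : (Uᶜ.filter (c < ·)).card = ∑ x ∈ (insert c U)ᶜ, if c < x then 1 else 0 := by
    rw [h, Finset.filter_insert, if_neg (lt_irrefl c), Finset.card_filter]
  rw [h1, h2, add_assoc, ← Finset.sum_add_distrib, crossings]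
  congr 1
  refine Finset.sum_congr rfl fun x _ => ?_
  rw [Finset.filter_insert]
  split_ifs
  · rw [Finset.card_insert_of_notMem (by simp [hc])]
  · rfl

theorem coinvPoly_eq {k : ℕ} (n : ℕ) (U : Finset (Fin k)) :
    coinvPoly n U = Polynomial.X ^ crossings U * stairsPoly k n Uᶜ.card := by
  induction n generalizing U with
  | zero =>
    by_cases hU : Uᶜ = ∅
    · have : ∀ c, c ∈ U := by simpa [Finset.eq_univ_iff_forall] using hU
      simp [coinvPoly, stairsPoly, stairs, crossings, hU, this, coinvRel]
    · have : ¬ ∀ c, c ∈ U := by simpa [Finset.eq_univ_iff_forall] using hU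
      have hU' : U ≠ Finset.univ := by simpa using hU
      simp [coinvPoly, stairsPoly, stairs, this]
      grind
  | succ n ih =>
    have hk : k = Uᶜ.card + U.card := by
      rw [Finset.card_compl_add_card, Fintype.card_fin]
    rw [coinvPoly_succ, ← Finset.sum_compl_add_sum U, stairsPoly_succ, Finset.mul_sum,
      show Finset.range k = Finset.range (Uᶜ.card + U.card) by rw [← hk], Finset.sum_range_add]
    congr 1
    · rw [← sum_card_filter_lt]
      refine Finset.sum_congr rfl fun c hc => ?_
      rw [Finset.mem_compl] at hc
      have hlt : (Uᶜ.filter (c < ·)).card < Uᶜ.card :=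
        Finset.card_lt_card (Finset.filter_ssubset.2 ⟨c, by simpa using hc, lt_irrefl c⟩)
      have hcard : (insert c U)ᶜ.card = Uᶜ.card - 1 := by
        rw [Finset.card_compl, Finset.card_compl, Finset.card_insert_of_notMem hc]; omega
      rw [ih, coinvStep, if_neg hc, if_pos hlt, hcard, ← mul_assoc, ← pow_add,
        crossings_insert U hc, pow_add, mul_assoc]
    · rw [← Finset.sum_range_reflect, ← sum_card_filter_lt]
      refine Finset.sum_congr rfl fun c hc => ?_
      have hlt : (U.filter (c < ·)).card < U.card :=
        Finset.card_lt_card (Finset.filter_ssubset.2 ⟨c, hc, lt_irrefl c⟩)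
      have e : Uᶜ.card + (U.card - 1 - (U.filter (c < ·)).card) =
        k - 1 - (U.filter (c < ·)).card := by omega
      rw [ih, coinvStep, if_pos hc, Finset.insert_eq_of_mem hc, if_neg (by omega), e]
      ring

theorem invRel_add_coinvRel {k n : ℕ} (U : Finset (Fin k)) (f : Fin n → Fin k)
    (hf : ∀ c, c ∈ U ∨ ∃ i, f i = c) :
    k ≤ U.card + n ∧ invRel U f + coinvRel U f =
      (U.card + n - k) * (k - 1) + ∑ i ∈ Finset.Ico U.card k, i := by
  induction n generalizing U with
  | zero =>
    have : U = Finset.univ := by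
      ext c; simpa using hf c
    simp [invRel, coinvRel, this]
  | succ n ih =>
    have hf' : ∀ c, c ∈ insert (f 0) U ∨ ∃ i, Fin.tail f i = c := by
      intro c
      have := hf c
      rw [Fin.exists_fin_succ] at this
      simp only [Finset.mem_insert, Fin.tail]
      grind
    obtain ⟨h1, h2⟩ := ih (insert (f 0) U) (Fin.tail f) hf'
    simp only [invRel, coinvRel, coinvStep]
    have hUk : U.card ≤ k := by simpa using Finset.card_le_univ U
    by_cases h0 : f 0 ∈ U
    · rw [Finset.insert_eq_of_mem h0] at h1 h2 ⊢
      have hlt : (U.filter (f 0 < ·)).card < U.card :=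
        Finset.card_lt_card (Finset.filter_ssubset.2 ⟨_, h0, lt_irrefl _⟩)
      refine ⟨by omega, ?_⟩
      rw [if_pos h0]
      have : U.card + (n + 1) - k = (U.card + n - k) + 1 := by omega
      rw [this, add_mul, one_mul]
      omega
    · rw [Finset.card_insert_of_notMem h0] at h1 h2
      refine ⟨by omega, ?_⟩
      rw [if_neg h0]
      have hlt : U.card < k := by
        have := Finset.card_le_univ (insert (f 0) U)
        rw [Finset.card_insert_of_notMem h0, Fintype.card_fin] at this
        omega
      have hs : (U.filter (f 0 < ·)).card + (U.filter (· < f 0)).card = U.card := by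
        rw [← Finset.card_union_of_disjoint, ← Finset.filter_or, Finset.filter_true_of_mem]
        · intro x hx
          rcases lt_trichotomy (f 0) x with h | h | h
          · exact Or.inl h
          · exact absurd (h ▸ hx) h0
          · exact Or.inr h
        · rw [Finset.disjoint_filter]
          intro x _ h h'
          exact lt_asymm h h'
      rw [Finset.sum_eq_sum_Ico_succ_bot hlt]
      have : U.card + (n + 1) - k = U.card + 1 + n - k := by omega
      rw [this]
      omega

theorem invRel_eq_sum {k n : ℕ} (U : Finset (Fin k)) (f : Fin n → Fin k) :
    invRel U f =
      ∑ j, (Finset.univ.filter fun c => f j < c ∧ (c ∈ U ∨ ∃ i < j, f i = c)).card := by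
  induction n generalizing U with
  | zero => simp [invRel]
  | succ n ih =>
    rw [Fin.sum_univ_succ, invRel, ih]
    congr 1
    · congr 1
      ext c
      simp [and_comm]
    · refine Finset.sum_congr rfl fun j _ => ?_
      congr 1
      ext c
      simp only [Finset.mem_filter, Finset.mem_univ, true_and, Finset.mem_insert, Fin.tail,
        Fin.exists_fin_succ, Fin.succ_lt_succ_iff, Fin.succ_pos]
      grind

theorem opInv_eq_invRel {k n : ℕ} (f : Fin n → Fin k) : opInv f = invRel ∅ f := by
  classical
  rw [invRel_eq_sum, ← Finset.card_sigma, opInv, ← Set.ncard_coe_finset]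
  refine Set.ncard_congr (fun p _ => ⟨p.2, f p.1⟩) ?_ ?_ ?_
  · rintro ⟨i, j⟩ ⟨h1, h2, h3⟩
    simp only [Finset.coe_sigma, Set.mem_sigma_iff]
    simp
    exact ⟨h3, i, h1, rfl⟩
  · rintro ⟨i, j⟩ ⟨i', j'⟩ ⟨h1, h2, h3⟩ ⟨h1', h2', h3'⟩ h
    simp only [Sigma.mk.injEq, heq_eq_eq] at h
    obtain ⟨rfl, h⟩ := h
    rcases lt_trichotomy i i' with hlt | rfl | hlt
    · exact absurd h (h2' i hlt)
    · rfl
    · exact absurd h.symm (h2 i' hlt)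
  · rintro ⟨j, c⟩ h
    simp only [Finset.coe_sigma, Set.mem_sigma_iff] at h
    simp at h
    obtain ⟨h1, h2⟩ := h
    have hne : (Finset.univ.filter fun i => i < j ∧ f i = c).Nonempty := by
      obtain ⟨i, hi⟩ := h2
      exact ⟨i, by simpa using hi⟩
    obtain ⟨i, hi, hmin⟩ := Finset.exists_minimal hne
    simp only [Finset.mem_filter, Finset.mem_univ, true_and] at hi hmin
    refine ⟨(i, j), ⟨hi.1, fun i' hi' h => ?_, by simpa [hi.2] using h1⟩, by simp [hi.2]⟩
    exact absurd (hmin ⟨hi'.trans hi.1, h.trans hi.2⟩ hi'.le) hi'.not_ge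

theorem opCoinv_eq_coinvRel {k n : ℕ} (f : Fin n → Fin k) (hf : Function.Surjective f) :
    opCoinv n k f = coinvRel ∅ f := by
  have h := (invRel_add_coinvRel ∅ f fun c => Or.inr (hf c)).2
  rw [Finset.card_empty, zero_add, ← Finset.range_eq_Ico, Finset.sum_range_id] at h
  rw [opCoinv, opInv_eq_invRel, ← h]
  omega

open Polynomial in
theorem sum_X_pow_opCoinv (n k : ℕ) :
    ∑ f : {f : Fin n → Fin k // Function.Surjective f}, (Polynomial.X : ℕ[X]) ^ opCoinv n k f.1 =
      stairsPoly k n k := by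
  classical
  have h := coinvPoly_eq n (∅ : Finset (Fin k))
  simp only [crossings, Finset.filter_empty, Finset.card_empty, Finset.sum_const_zero, pow_zero,
    one_mul, Finset.compl_empty, Finset.card_univ, Fintype.card_fin] at h
  rw [← h, coinvPoly, Finset.sum_subtype (p := Function.Surjective)]
  · exact Finset.sum_congr rfl fun f _ => by rw [opCoinv_eq_coinvRel f.1 f.2]
  · intro f
    simp [Function.Surjective]

theorem card_stairs (n k : ℕ) :
    (stairs k n k).card = Nat.card {f : Fin n → Fin k // Function.Surjective f} := by
  classical
  have h := congrArg (Polynomial.eval 1) (sum_X_pow_opCoinv n k)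
  simp [stairsPoly, Polynomial.eval_finsetSum] at h
  rw [Nat.card_eq_fintype_card, h]

theorem card_stairs_filter (n k d : ℕ) :
    ((stairs k n k).filter fun m => ∑ i, m i = d).card =
      Nat.card {f : Fin n → Fin k // Function.Surjective f ∧ opCoinv n k f = d} := by
  classical
  have h := congrArg (fun p => Polynomial.coeff p d) (sum_X_pow_opCoinv n k)
  simp only [stairsPoly, Polynomial.finsetSum_coeff, Polynomial.coeff_X_pow] at h
  rw [Finset.card_filter]
  simp only [eq_comm (a := d)] at h
  rw [← h, ← Finset.card_filter, Nat.card_congr (Equiv.subtypeSubtypeEquivSubtypeInter _ _).symm,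
    Nat.card_eq_fintype_card, Fintype.card_subtype]

theorem esymm_fin_succ (n d : ℕ) :
    esymm (Fin (n + 1)) ℚ (d + 1) =
      rename Fin.succ (esymm (Fin n) ℚ (d + 1)) + X 0 * rename Fin.succ (esymm (Fin n) ℚ d) := by
  have h (e : ℕ) : rename Fin.succ (esymm (Fin n) ℚ e) =
      (Finset.univ.val.map fun i : Fin n => (X i.succ : MvPolynomial (Fin (n + 1)) ℚ)).esymm e := by
    simp only [esymm, map_sum, map_prod, rename_X, Finset.esymm_map_val]
  have hu : (Finset.univ : Finset (Fin (n + 1))).val =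
      0 ::ₘ (Finset.univ : Finset (Fin n)).val.map Fin.succ := by
    rw [Fin.univ_succ]
    rfl
  rw [esymm_eq_multiset_esymm, h, h, hu, Multiset.map_cons, Multiset.map_map, Multiset.esymm,
    Multiset.powersetCard_cons, Multiset.map_add, Multiset.sum_add, Multiset.map_map]
  simp only [Function.comp_def, Multiset.prod_cons, Multiset.sum_map_mul_left]
  rfl

theorem esymm_eq_zero {n d : ℕ} (h : n < d) : esymm (Fin n) ℚ d = 0 := by
  rw [esymm, Finset.powersetCard_eq_empty.2 (by simpa using h), Finset.sum_empty]

/-- The ideal generated by the `k`-th powers of the variables and the elementary symmetric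
polynomials of degree greater than `n - s`. -/
noncomputable def levelIdeal (n k s : ℕ) : Ideal (MvPolynomial (Fin n) ℚ) :=
  Ideal.span ({p | ∃ i : Fin n, p = X i ^ k} ∪
    {p | ∃ d : ℕ, n + 1 ≤ d + s ∧ p = esymm (Fin n) ℚ d})

theorem X_pow_mem_levelIdeal {n k s : ℕ} (i : Fin n) : X i ^ k ∈ levelIdeal n k s :=
  Ideal.subset_span (Or.inl ⟨i, rfl⟩)

theorem esymm_mem_levelIdeal {n k s d : ℕ} (h : n + 1 ≤ d + s) :
    esymm (Fin n) ℚ d ∈ levelIdeal n k s :=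
  Ideal.subset_span (Or.inr ⟨d, h, rfl⟩)

theorem levelIdeal_le_Ink {n k : ℕ} (hkn : k ≤ n) : levelIdeal n k k ≤ Ink n k := by
  refine Ideal.span_le.2 ?_
  rintro p (⟨i, rfl⟩ | ⟨d, hd, rfl⟩)
  · exact Ideal.subset_span (Or.inl ⟨i, rfl⟩)
  · by_cases h : d ≤ n
    · exact Ideal.subset_span (Or.inr ⟨d, by omega, h, rfl⟩)
    · rw [esymm_eq_zero (not_le.1 h)]
      exact Ideal.zero_mem _

theorem X_pow_mul_rename_esymm_mem {n k s d t : ℕ} (h1 : n + 1 ≤ d + t) (h2 : n + 1 ≤ d + s) :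
    X 0 ^ t * rename Fin.succ (esymm (Fin n) ℚ d) ∈ levelIdeal (n + 1) k s := by
  induction t generalizing d with
  | zero =>
    rw [esymm_eq_zero (by omega), map_zero, mul_zero]
    exact Ideal.zero_mem _
  | succ t ih =>
    have e : (X 0 : MvPolynomial (Fin (n + 1)) ℚ) ^ (t + 1) *
          rename Fin.succ (esymm (Fin n) ℚ d) =
        X 0 ^ t * esymm (Fin (n + 1)) ℚ (d + 1) -
          X 0 ^ t * rename Fin.succ (esymm (Fin n) ℚ (d + 1)) := by
      rw [esymm_fin_succ]; ring
    rw [e]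
    exact sub_mem (Ideal.mul_mem_left _ _ (esymm_mem_levelIdeal (by omega)))
      (ih (by omega) (by omega))

theorem X_pow_mul_rename_mem {n k s j : ℕ} {p : MvPolynomial (Fin n) ℚ}
    (hp : p ∈ levelIdeal n k (if j < s then s - 1 else s)) :
    X 0 ^ j * rename Fin.succ p ∈ levelIdeal (n + 1) k s ⊔ Ideal.span {X 0 ^ (j + 1)} := by
  induction hp using Submodule.span_induction with
  | zero => simp
  | add x y _ _ hx hy => rw [map_add, mul_add]; exact add_mem hx hy
  | smul a x _ hx =>
    rw [smul_eq_mul, map_mul, mul_left_comm]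
    exact Ideal.mul_mem_left _ _ hx
  | mem x hx =>
    rcases hx with ⟨i, rfl⟩ | ⟨d, hd, rfl⟩
    · rw [map_pow, rename_X]
      exact Ideal.mul_mem_left _ _ (Ideal.mem_sup_left (X_pow_mem_levelIdeal _))
    · by_cases hds : n + 2 ≤ d + s
      · obtain _ | d := d
        · refine Ideal.mem_sup_left ?_
          have : (1 : MvPolynomial (Fin (n + 1)) ℚ) ∈ levelIdeal (n + 1) k s := by
            rw [← esymm_zero (Fin (n + 1)) ℚ]
            exact esymm_mem_levelIdeal hds
          exact (Ideal.eq_top_iff_one _).2 this ▸ Submodule.mem_top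
        · have e : (X 0 : MvPolynomial (Fin (n + 1)) ℚ) ^ j *
                rename Fin.succ (esymm (Fin n) ℚ (d + 1)) =
              X 0 ^ j * esymm (Fin (n + 1)) ℚ (d + 1) -
                rename Fin.succ (esymm (Fin n) ℚ d) * X 0 ^ (j + 1) := by
            rw [esymm_fin_succ]; ring
          rw [e]
          exact sub_mem
            (Ideal.mul_mem_left _ _ (Ideal.mem_sup_left (esymm_mem_levelIdeal (by omega))))
            (Ideal.mul_mem_left _ _ (Ideal.mem_sup_right (Ideal.subset_span rfl)))
      · have hjs : ¬ j < s := by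
          intro h
          rw [if_pos h] at hd
          omega
        rw [if_neg hjs] at hd
        exact Ideal.mem_sup_left (X_pow_mul_rename_esymm_mem (by omega) (by omega))

/-- The monomial with exponent vector `m`. -/
noncomputable def expMonomial {n : ℕ} (m : Fin n → ℕ) : MvPolynomial (Fin n) ℚ :=
  ∏ i, X i ^ m i

theorem expMonomial_cons {n : ℕ} (j : ℕ) (m : Fin n → ℕ) :
    expMonomial (Fin.cons j m : Fin (n + 1) → ℕ) = X 0 ^ j * rename Fin.succ (expMonomial m) := by
  simp [expMonomial, Fin.prod_univ_succ, map_prod]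

theorem isHomogeneous_expMonomial {n : ℕ} (m : Fin n → ℕ) :
    (expMonomial m).IsHomogeneous (∑ i, m i) :=
  IsHomogeneous.prod _ _ _ fun i _ => isHomogeneous_X_pow i (m i)

theorem exists_eq_rename_succ_add_X_mul {n : ℕ} (p : MvPolynomial (Fin (n + 1)) ℚ) :
    ∃ (q : MvPolynomial (Fin n) ℚ) (r : MvPolynomial (Fin (n + 1)) ℚ),
      p = rename Fin.succ q + X 0 * r := by
  induction p using MvPolynomial.induction_on with
  | C a => exact ⟨C a, 0, by simp⟩
  | add p p' hp hp' =>
    obtain ⟨q, r, rfl⟩ := hp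
    obtain ⟨q', r', rfl⟩ := hp'
    exact ⟨q + q', r + r', by rw [map_add]; ring⟩
  | mul_X p i hp =>
    obtain ⟨q, r, rfl⟩ := hp
    refine Fin.cases ⟨0, rename Fin.succ q + X 0 * r, by rw [map_zero]; ring⟩ (fun i => ?_) i
    exact ⟨q * X i, r * X i.succ, by rw [map_mul, rename_X]; ring⟩

theorem span_stairs_sup_levelIdeal (n k s : ℕ) :
    Submodule.span ℚ (expMonomial '' (stairs k n s : Set (Fin n → ℕ))) ⊔
      (levelIdeal n k s).restrictScalars ℚ = ⊤ := by
  induction n generalizing s with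
  | zero =>
    rw [eq_top_iff]
    rintro p -
    by_cases hs : s = 0
    · refine Submodule.mem_sup_left ?_
      rw [eq_C_of_isEmpty p, C_eq_smul_one]
      refine Submodule.smul_mem _ _ (Submodule.subset_span ⟨default, ?_, ?_⟩)
      · rw [stairs, if_pos hs]
        exact Finset.mem_coe.2 (Finset.mem_univ _)
      · simp [expMonomial]
    · refine Submodule.mem_sup_right ?_
      have : (1 : MvPolynomial (Fin 0) ℚ) ∈ levelIdeal 0 k s := by
        rw [← esymm_zero (Fin 0) ℚ]
        exact esymm_mem_levelIdeal (by omega)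
      exact (Ideal.eq_top_iff_one _).2 this ▸ Submodule.mem_top
  | succ n ih =>
    set T := Submodule.span ℚ (expMonomial '' (stairs k (n + 1) s : Set (Fin (n + 1) → ℕ))) ⊔
      (levelIdeal (n + 1) k s).restrictScalars ℚ with hT
    have key : ∀ i j, i + j = k → ∀ p, X 0 ^ j * p ∈ T := by
      intro i
      induction i with
      | zero =>
        rintro j hj p
        obtain rfl : j = k := by omega
        exact Submodule.mem_sup_right (Ideal.mul_mem_right _ _ (X_pow_mem_levelIdeal 0))
      | succ i ihi =>
        intro j hj p
        have hX : ∀ r, X 0 ^ j * (X 0 * r) ∈ T := fun r => by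
          rw [← mul_assoc, ← pow_succ]
          exact ihi (j + 1) (by omega) r
        obtain ⟨q, r, rfl⟩ := exists_eq_rename_succ_add_X_mul p
        rw [mul_add]
        refine add_mem ?_ (hX r)
        have hq : q ∈ (⊤ : Submodule ℚ (MvPolynomial (Fin n) ℚ)) := Submodule.mem_top
        rw [← ih (if j < s then s - 1 else s)] at hq
        obtain ⟨w, hw, u, hu, rfl⟩ := Submodule.mem_sup.1 hq
        clear hq
        rw [map_add, mul_add]
        refine add_mem ?_ ?_
        · refine Submodule.mem_sup_left ?_
          induction hw using Submodule.span_induction with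
          | zero => simp
          | add x y _ _ hx hy =>
            rw [map_add, mul_add]
            exact add_mem hx hy
          | smul a x _ hx =>
            rw [map_smul, mul_smul_comm]
            exact Submodule.smul_mem _ _ hx
          | mem x hx =>
            obtain ⟨m, hm, rfl⟩ := hx
            rw [← expMonomial_cons]
            refine Submodule.subset_span ⟨_, ?_, rfl⟩
            refine Finset.mem_coe.2 (Finset.mem_map.2 ⟨⟨j, m⟩, ?_, rfl⟩)
            exact Finset.mem_sigma.2 ⟨Finset.mem_range.2 (show j < k by omega), hm⟩
        · obtain ⟨y, hy, z, hz, e⟩ := Submodule.mem_sup.1 (X_pow_mul_rename_mem hu)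
          rw [← e]
          obtain ⟨z, rfl⟩ := Ideal.mem_span_singleton'.1 hz
          refine add_mem (Submodule.mem_sup_right hy) ?_
          rw [mul_comm]
          exact ihi (j + 1) (by omega) z
    rw [eq_top_iff]
    rintro p -
    simpa using key k 0 (by omega) p

theorem coeff_prod_one_add_C_mul_X {ι R : Type*} [CommRing R] (s : Finset ι) (x : ι → R) (d : ℕ) :
    (∏ i ∈ s, (1 + Polynomial.C (x i) * Polynomial.X)).coeff d = (s.val.map x).esymm d := by
  rw [Finset.prod_one_add, Finset.esymm_map_val, Polynomial.finsetSum_coeff,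
    Finset.powersetCard_eq_filter, Finset.sum_filter]
  refine Finset.sum_congr rfl fun t _ => ?_
  rw [Finset.prod_mul_distrib, Finset.prod_const, ← map_prod, Polynomial.coeff_C_mul_X_pow]
  simp only [eq_comm (a := d)]

/-- Evaluation of polynomials at the points `(f 0, …, f (n - 1))` for `f` surjective. -/
noncomputable def evalSurj (n k : ℕ) :
    MvPolynomial (Fin n) ℚ →ₐ[ℚ] ({f : Fin n → Fin k // Function.Surjective f} → ℚ) :=
  aeval fun i f => ((f.1 i : ℕ) : ℚ)

theorem evalSurj_X {n k : ℕ} (i : Fin n) (f : {f : Fin n → Fin k // Function.Surjective f}) :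
    evalSurj n k (X i) f = ((f.1 i : ℕ) : ℚ) := by
  simp [evalSurj]

theorem evalSurj_esymm {n k : ℕ} (d : ℕ) (f : {f : Fin n → Fin k // Function.Surjective f}) :
    evalSurj n k (esymm (Fin n) ℚ d) f =
      (∏ i, (1 + Polynomial.C ((f.1 i : ℕ) : ℚ) * Polynomial.X)).coeff d := by
  rw [coeff_prod_one_add_C_mul_X, Finset.esymm_map_val]
  simp [esymm, evalSurj_X]

theorem evalSurj_surjective (n k : ℕ) : Function.Surjective (evalSurj n k) := by
  classical
  intro g
  have hinj : Set.InjOn (fun c : Fin k => ((c : ℕ) : ℚ)) (Finset.univ : Finset (Fin k)) := by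
    intro a _ b _ h
    exact Fin.ext (Nat.cast_injective h)
  let L (c : Fin k) : Polynomial ℚ := Lagrange.basis Finset.univ (fun c : Fin k => ((c : ℕ) : ℚ)) c
  have hL (a b : Fin k) : (L a).eval ((b : ℕ) : ℚ) = if a = b then 1 else 0 := by
    split_ifs with h
    · subst h
      exact Lagrange.eval_basis_self hinj (Finset.mem_univ a)
    · exact Lagrange.eval_basis_of_ne (v := fun c : Fin k => ((c : ℕ) : ℚ)) h (Finset.mem_univ b)
  refine ⟨∑ f, C (g f) * ∏ i, Polynomial.aeval (X i) (L (f.1 i)), ?_⟩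
  funext f'
  have h1 (p : Polynomial ℚ) (i : Fin n) :
      evalSurj n k (Polynomial.aeval (X i) p) f' = p.eval ((f'.1 i : ℕ) : ℚ) := by
    have := Polynomial.aeval_algHom_apply ((Pi.evalAlgHom ℚ _ f').comp (evalSurj n k)) (X i) p
    simp only [AlgHom.comp_apply, Pi.evalAlgHom_apply, evalSurj_X] at this
    rw [← this, Polynomial.coe_aeval_eq_eval]
  have h2 (f : {f : Fin n → Fin k // Function.Surjective f}) :
      ∏ i, (if f.1 i = f'.1 i then (1 : ℚ) else 0) = if f = f' then 1 else 0 := by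
    rw [Finset.prod_ite_zero]
    simp [Subtype.ext_iff, _root_.funext_iff]
  simp [map_sum, map_mul, map_prod, Finset.sum_apply, Finset.prod_apply, h1, h2, hL]

/-- The functions obtained by evaluating polynomials of degree less than `d`. -/
noncomputable def lowDegree (n k d : ℕ) :
    Submodule ℚ ({f : Fin n → Fin k // Function.Surjective f} → ℚ) :=
  Submodule.span ℚ (evalSurj n k '' {p | ∃ e < d, p.IsHomogeneous e})

theorem evalSurj_mem_lowDegree {n k d e : ℕ} {p : MvPolynomial (Fin n) ℚ} (hp : p.IsHomogeneous e)
    (he : e < d) : evalSurj n k p ∈ lowDegree n k d :=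
  Submodule.subset_span ⟨p, ⟨e, he, hp⟩, rfl⟩

theorem X_mul_mem_lowDegree {n k d : ℕ} (i : Fin n)
    {v : {f : Fin n → Fin k // Function.Surjective f} → ℚ} (hv : v ∈ lowDegree n k d) :
    evalSurj n k (X i) * v ∈ lowDegree n k (d + 1) := by
  induction hv using Submodule.span_induction with
  | zero => simp
  | add x y _ _ hx hy => rw [mul_add]; exact add_mem hx hy
  | smul a x _ hx => rw [mul_smul_comm]; exact Submodule.smul_mem _ _ hx
  | mem x hx =>
    obtain ⟨p, ⟨e, he, hp⟩, rfl⟩ := hx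
    rw [← map_mul]
    exact evalSurj_mem_lowDegree ((isHomogeneous_X ℚ i).mul hp) (by omega)

theorem evalSurj_X_pow_mem_lowDegree {n k : ℕ} (i : Fin n) :
    evalSurj n k (X i ^ k) ∈ lowDegree n k k := by
  set P : Polynomial ℚ := ∏ c ∈ Finset.range k, (Polynomial.X - Polynomial.C (c : ℚ)) with hP
  have hmonic : P.Monic := Polynomial.monic_prod_of_monic _ _ fun c _ => Polynomial.monic_X_sub_C _
  have hdeg : P.natDegree = k := by
    rw [hP, Polynomial.natDegree_prod_of_monic _ _ fun c _ => Polynomial.monic_X_sub_C _]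
    simp only [Polynomial.natDegree_X_sub_C, Finset.sum_const, Finset.card_range, smul_eq_mul,
      mul_one]
  have h : evalSurj n k (X i ^ k) =
      -∑ j ∈ Finset.range k, P.coeff j • evalSurj n k (X i ^ j) := by
    funext f
    have h0 : P.eval ((f.1 i : ℕ) : ℚ) = 0 := by
      rw [hP, Polynomial.eval_prod]
      exact Finset.prod_eq_zero (Finset.mem_range.2 (f.1 i).2) (by simp)
    rw [hmonic.as_sum, hdeg, Polynomial.eval_add, Polynomial.eval_finsetSum] at h0
    simp only [Polynomial.eval_pow, Polynomial.eval_X, Polynomial.eval_mul,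
      Polynomial.eval_C] at h0
    simp only [map_pow, Pi.pow_apply, Pi.neg_apply, Finset.sum_apply, Pi.smul_apply, evalSurj_X,
      smul_eq_mul]
    linarith
  rw [h]
  refine neg_mem (sum_mem fun j hj => Submodule.smul_mem _ _ ?_)
  exact evalSurj_mem_lowDegree (isHomogeneous_X_pow i j) (Finset.mem_range.1 hj)

theorem isHomogeneous_esymm (n d : ℕ) : (esymm (Fin n) ℚ d).IsHomogeneous d := by
  refine IsHomogeneous.sum _ _ _ fun t ht => ?_
  have := IsHomogeneous.prod t (fun i => (X i : MvPolynomial (Fin n) ℚ)) (fun _ => 1)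
    fun i _ => isHomogeneous_X ℚ i
  rwa [Finset.sum_const, (Finset.mem_powersetCard.1 ht).2, smul_eq_mul, mul_one] at this

theorem exists_prod_one_add_eq_mul {n k : ℕ} {f : Fin n → Fin k} (hf : Function.Surjective f)
    (a : Fin k → ℚ) :
    ∃ Q : Polynomial ℚ, Q.natDegree ≤ n - k ∧
      ∏ i, (1 + Polynomial.C (a (f i)) * Polynomial.X) =
        (∏ c, (1 + Polynomial.C (a c) * Polynomial.X)) * Q := by
  classical
  obtain ⟨g, hg⟩ := hf.hasRightInverse
  have hginj : Function.Injective g := hg.injective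
  refine ⟨∏ i ∈ Finset.univ \ Finset.univ.image g, (1 + Polynomial.C (a (f i)) * Polynomial.X),
    ?_, ?_⟩
  · refine (Polynomial.natDegree_prod_le _ _).trans ?_
    have h1 : ∀ i ∈ Finset.univ \ Finset.univ.image g,
        (1 + Polynomial.C (a (f i)) * Polynomial.X).natDegree ≤ 1 := fun i _ => by
      compute_degree
    refine (Finset.sum_le_sum h1).trans ?_
    rw [Finset.sum_const, Finset.card_sdiff_of_subset (Finset.subset_univ _),
      Finset.card_image_of_injective _ hginj]
    simp
  · rw [← Finset.prod_sdiff (Finset.subset_univ (Finset.univ.image g)), mul_comm,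
      Finset.prod_image hginj.injOn]
    simp only [hg _]

theorem evalSurj_esymm_mem_lowDegree {n k d : ℕ} (hd : n - k + 1 ≤ d) :
    evalSurj n k (esymm (Fin n) ℚ d) ∈ lowDegree n k d := by
  set P : Polynomial ℚ := ∏ c : Fin k, (1 + Polynomial.C ((c : ℕ) : ℚ) * Polynomial.X) with hP
  have hP0 : PowerSeries.constantCoeff (P : PowerSeries ℚ) = 1 := by
    rw [← PowerSeries.coeff_zero_eq_constantCoeff_apply, Polynomial.coeff_coe,
      Polynomial.coeff_zero_eq_eval_zero, hP, Polynomial.eval_prod]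
    simp
  set B : PowerSeries ℚ := (P : PowerSeries ℚ)⁻¹ with hB
  have hPB : (P : PowerSeries ℚ) * B = 1 := PowerSeries.mul_inv_cancel _ (by rw [hP0]; simp)
  have hB0 : PowerSeries.coeff 0 B = 1 := by
    rw [PowerSeries.coeff_zero_eq_constantCoeff_apply, hB, PowerSeries.constantCoeff_inv, hP0,
      inv_one]
  have h : evalSurj n k (esymm (Fin n) ℚ d) =
      -∑ j ∈ Finset.range d, PowerSeries.coeff (d - j) B • evalSurj n k (esymm (Fin n) ℚ j) := by
    funext f
    obtain ⟨Q, hQ, hprod⟩ := exists_prod_one_add_eq_mul f.2 fun c => ((c : ℕ) : ℚ)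
    set A : Polynomial ℚ := ∏ i, (1 + Polynomial.C ((f.1 i : ℕ) : ℚ) * Polynomial.X) with hA
    have hAB : (A : PowerSeries ℚ) * B = Q := by
      rw [hprod, ← hP, Polynomial.coe_mul, mul_right_comm, hPB, one_mul]
    have h0 := congrArg (PowerSeries.coeff d) hAB
    rw [Polynomial.coeff_coe, Polynomial.coeff_eq_zero_of_natDegree_lt (by omega),
      PowerSeries.coeff_mul, Finset.Nat.sum_antidiagonal_eq_sum_range_succ_mk,
      Finset.sum_range_succ, Nat.sub_self, hB0, mul_one] at h0
    simp only [Polynomial.coeff_coe] at h0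
    simp only [Pi.neg_apply, Finset.sum_apply, Pi.smul_apply, evalSurj_esymm, smul_eq_mul, ← hA]
    simp only [mul_comm (PowerSeries.coeff _ B)]
    linarith
  rw [h]
  refine neg_mem (sum_mem fun j hj => Submodule.smul_mem _ _ ?_)
  exact evalSurj_mem_lowDegree (isHomogeneous_esymm n j) (Finset.mem_range.1 hj)

theorem homogeneousComponent_X_mul {n : ℕ} (i : Fin n) (d : ℕ) (p : MvPolynomial (Fin n) ℚ) :
    homogeneousComponent (d + 1) (X i * p) = X i * homogeneousComponent d p := by
  induction p using MvPolynomial.induction_on' with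
  | add p q hp hq => rw [mul_add, map_add, hp, hq, map_add, mul_add]
  | monomial u a =>
    have h := isHomogeneous_monomial (σ := Fin n) a (rfl : u.degree = u.degree)
    rw [homogeneousComponent_of_mem h, homogeneousComponent_of_mem ((isHomogeneous_X ℚ i).mul h)]
    simp only [add_comm 1, add_left_inj, mul_ite, mul_zero]

theorem evalSurj_homogeneousComponent_mem {n k : ℕ} {p : MvPolynomial (Fin n) ℚ}
    (hp : p ∈ Ink n k) (d : ℕ) :
    evalSurj n k (homogeneousComponent d p) ∈ lowDegree n k d := by
  induction hp using Submodule.span_induction generalizing d with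
  | zero => simp
  | add x y _ _ hx hy => rw [map_add, map_add]; exact add_mem (hx d) (hy d)
  | smul a x _ hx =>
    rw [smul_eq_mul]
    induction a using MvPolynomial.induction_on generalizing d with
    | C a =>
      rw [homogeneousComponent_C_mul, C_mul', map_smul]
      exact Submodule.smul_mem _ _ (hx d)
    | add a b ha hb => rw [add_mul, map_add, map_add]; exact add_mem (ha d) (hb d)
    | mul_X a i ha =>
      rw [mul_comm a, mul_assoc]
      obtain _ | d := d
      · simp [coeff_zero_X, coeff_mul]
      · rw [homogeneousComponent_X_mul, map_mul]
        exact X_mul_mem_lowDegree i (ha d)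
  | mem x hx =>
    rcases hx with ⟨i, rfl⟩ | ⟨e, he, _, rfl⟩
    · rw [homogeneousComponent_of_mem (isHomogeneous_X_pow i k)]
      split_ifs with h
      · exact h ▸ evalSurj_X_pow_mem_lowDegree i
      · simp
    · rw [homogeneousComponent_of_mem (isHomogeneous_esymm n e)]
      split_ifs with h
      · subst h; exact evalSurj_esymm_mem_lowDegree he
      · simp

theorem homogeneousComponent_mem_span {n : ℕ} {S : Set (Fin n → ℕ)} {p : MvPolynomial (Fin n) ℚ}
    (hp : p ∈ Submodule.span ℚ (expMonomial '' S)) (d : ℕ) :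
    homogeneousComponent d p ∈ Submodule.span ℚ (expMonomial '' {m ∈ S | ∑ i, m i = d}) := by
  induction hp using Submodule.span_induction with
  | zero => simp
  | add x y _ _ hx hy => rw [map_add]; exact add_mem hx hy
  | smul a x _ hx => rw [map_smul]; exact Submodule.smul_mem _ _ hx
  | mem x hx =>
    obtain ⟨m, hm, rfl⟩ := hx
    rw [homogeneousComponent_of_mem (isHomogeneous_expMonomial m)]
    split_ifs with h
    · exact Submodule.subset_span ⟨m, ⟨hm, h.symm⟩, rfl⟩
    · exact zero_mem _

theorem exists_add_mem_Ink {n k : ℕ} (hkn : k ≤ n) (p : MvPolynomial (Fin n) ℚ) :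
    ∃ w ∈ Submodule.span ℚ (expMonomial '' (stairs k n k : Set (Fin n → ℕ))), ∃ r ∈ Ink n k,
      w + r = p := by
  have hp : p ∈ (⊤ : Submodule ℚ (MvPolynomial (Fin n) ℚ)) := Submodule.mem_top
  rw [← span_stairs_sup_levelIdeal n k k] at hp
  obtain ⟨w, hw, r, hr, e⟩ := Submodule.mem_sup.1 hp
  exact ⟨w, hw, r, levelIdeal_le_Ink hkn hr, e⟩

theorem lowDegree_le_span {n k : ℕ} (hkn : k ≤ n) (d : ℕ) :
    lowDegree n k d ≤ Submodule.span ℚ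
      ((fun m => evalSurj n k (expMonomial m)) '' {m ∈ (stairs k n k : Set _) | ∑ i, m i < d}) := by
  induction d with
  | zero => exact Submodule.span_le.2 (by rintro _ ⟨p, ⟨e, he, _⟩, rfl⟩; omega)
  | succ d ih =>
    have hsub : {m ∈ (stairs k n k : Set (Fin n → ℕ)) | ∑ i, m i < d} ⊆
        {m ∈ (stairs k n k : Set (Fin n → ℕ)) | ∑ i, m i < d + 1} :=
      fun m hm => ⟨hm.1, hm.2.trans d.lt_succ_self⟩
    have ih' := ih.trans (Submodule.span_mono (Set.image_mono hsub))
    refine Submodule.span_le.2 ?_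
    rintro _ ⟨p, ⟨e, he, hp⟩, rfl⟩
    rcases (Nat.lt_succ_iff.1 he).lt_or_eq with he | rfl
    · exact ih' (evalSurj_mem_lowDegree hp he)
    · obtain ⟨w, hw, r, hr, rfl⟩ := exists_add_mem_Ink hkn p
      rw [← homogeneousComponent_eq_self hp, map_add, map_add]
      refine add_mem ?_ (ih' (evalSurj_homogeneousComponent_mem hr e))
      have h := Submodule.mem_map_of_mem (f := (evalSurj n k).toLinearMap)
        (homogeneousComponent_mem_span hw e)
      rw [Submodule.map_span, Set.image_image] at h
      refine Submodule.span_mono ?_ h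
      rintro _ ⟨m, hm, rfl⟩
      exact ⟨m, ⟨hm.1, Nat.lt_succ_iff.2 hm.2.le⟩, rfl⟩

theorem linearIndependent_evalSurj {n k : ℕ} (hkn : k ≤ n) :
    LinearIndependent ℚ fun m : stairs k n k => evalSurj n k (expMonomial m.1) := by
  classical
  refine linearIndependent_of_top_le_span_of_card_eq_finrank ?_ ?_
  · rintro v -
    obtain ⟨p, rfl⟩ := evalSurj_surjective n k v
    rw [← sum_homogeneousComponent p, map_sum]
    refine sum_mem fun e _ => ?_
    refine Submodule.span_mono ?_ (lowDegree_le_span hkn (e + 1)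
      (evalSurj_mem_lowDegree (homogeneousComponent_isHomogeneous e p) e.lt_succ_self))
    rintro _ ⟨m, hm, rfl⟩
    exact ⟨⟨m, hm.1⟩, rfl⟩
  · rw [Module.finrank_fintype_fun_eq_card, Fintype.card_coe, card_stairs,
      Nat.card_eq_fintype_card]

theorem evalSurj_eq_zero_of_mem_span_of_mem_Ink {n k : ℕ} (hkn : k ≤ n) (d : ℕ) :
    ∀ p ∈ Submodule.span ℚ (expMonomial '' {m ∈ (stairs k n k : Set _) | ∑ i, m i = d}),
      p ∈ Ink n k → evalSurj n k p = 0 := by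
  intro p hp hpI
  have hhom : p.IsHomogeneous d := by
    refine (Submodule.span_le (p := homogeneousSubmodule (Fin n) ℚ d)).2 ?_ hp
    rintro _ ⟨m, hm, rfl⟩
    exact hm.2 ▸ isHomogeneous_expMonomial m
  have h1 := lowDegree_le_span hkn d (evalSurj_homogeneousComponent_mem hpI d)
  rw [homogeneousComponent_eq_self hhom] at h1
  have h2 := Submodule.mem_map_of_mem (f := (evalSurj n k).toLinearMap) hp
  rw [Submodule.map_span, Set.image_image] at h2
  have hdisj := (linearIndependent_evalSurj hkn).disjoint_span_image
    (s := {m | ∑ i, m.1 i < d}) (t := {m | ∑ i, m.1 i = d})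
    (Set.disjoint_left.2 fun m (h : _ < d) (h' : _ = d) => by omega)
  refine Submodule.disjoint_def.1 hdisj _ (Submodule.span_mono ?_ h1) (Submodule.span_mono ?_ h2)
  · rintro _ ⟨m, hm, rfl⟩
    exact ⟨⟨m, hm.1⟩, hm.2, rfl⟩
  · rintro _ ⟨m, hm, rfl⟩
    exact ⟨⟨m, hm.1⟩, hm.2, rfl⟩

theorem homogeneousComponent_mem_Ink {n k : ℕ} {p : MvPolynomial (Fin n) ℚ} (hp : p ∈ Ink n k)
    (d : ℕ) : homogeneousComponent d p ∈ Ink n k := by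
  let := MvPolynomial.gradedAlgebra (σ := Fin n) (R := ℚ)
  refine homogeneousComponent_mem_of_mem (Ideal.homogeneous_span _ _ ?_) hp d
  rintro x (⟨i, rfl⟩ | ⟨e, -, -, rfl⟩)
  · exact ⟨k, isHomogeneous_X_pow i k⟩
  · exact ⟨e, isHomogeneous_esymm n e⟩

theorem map_homogeneousSubmodule_eq_span {n k : ℕ} (hkn : k ≤ n) (d : ℕ) :
    Submodule.map (Ideal.Quotient.mkₐ ℚ (Ink n k)).toLinearMap (homogeneousSubmodule (Fin n) ℚ d) =
      Submodule.span ℚ (Set.range fun m : (stairs k n k).filter fun m => ∑ i, m i = d =>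
        Ideal.Quotient.mkₐ ℚ (Ink n k) (expMonomial m.1)) := by
  apply le_antisymm
  · rintro _ ⟨p, hp, rfl⟩
    obtain ⟨w, hw, r, hr, rfl⟩ := exists_add_mem_Ink hkn p
    rw [← homogeneousComponent_eq_self hp, map_add, map_add]
    have hr0 : (Ideal.Quotient.mkₐ ℚ (Ink n k)).toLinearMap (homogeneousComponent d r) = 0 :=
      Ideal.Quotient.eq_zero_iff_mem.2 (homogeneousComponent_mem_Ink hr d)
    rw [hr0, add_zero]
    have h := Submodule.mem_map_of_mem (f := (Ideal.Quotient.mkₐ ℚ (Ink n k)).toLinearMap)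
      (homogeneousComponent_mem_span hw d)
    rw [Submodule.map_span, Set.image_image] at h
    refine Submodule.span_mono ?_ h
    rintro _ ⟨m, hm, rfl⟩
    exact ⟨⟨m, Finset.mem_filter.2 hm⟩, rfl⟩
  · refine Submodule.span_le.2 ?_
    rintro _ ⟨m, rfl⟩
    refine ⟨expMonomial m.1, ?_, rfl⟩
    have h := isHomogeneous_expMonomial m.1
    rwa [(Finset.mem_filter.1 m.2).2] at h

theorem linearIndependent_mk_expMonomial {n k : ℕ} (hkn : k ≤ n) (d : ℕ) :
    LinearIndependent ℚ fun m : (stairs k n k).filter fun m => ∑ i, m i = d =>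
      Ideal.Quotient.mkₐ ℚ (Ink n k) (expMonomial m.1) := by
  let incl (m : (stairs k n k).filter fun m => ∑ i, m i = d) : stairs k n k :=
    ⟨m.1, Finset.mem_of_mem_filter _ m.2⟩
  have hincl : Function.Injective incl := fun a b h =>
    Subtype.ext (congrArg (fun m : stairs k n k => m.1) h)
  have hind := (linearIndependent_evalSurj hkn).comp incl hincl
  rw [Fintype.linearIndependent_iff] at hind ⊢
  intro g hg
  refine hind g ?_
  simp only [← map_smul, ← map_sum] at hg
  change ∑ m, g m • evalSurj n k (expMonomial m.1) = 0
  simp only [← map_smul, ← map_sum]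
  refine evalSurj_eq_zero_of_mem_span_of_mem_Ink hkn d _ (sum_mem fun m _ => ?_)
    (Ideal.Quotient.eq_zero_iff_mem.1 hg)
  exact Submodule.smul_mem _ _ (Submodule.subset_span ⟨m.1, Finset.mem_filter.1 m.2, rfl⟩)

theorem stmt6 (n k : ℕ) (hk : 1 ≤ k) (hkn : k ≤ n) (d : ℕ) :
    Module.finrank ℚ
      (Submodule.map (Ideal.Quotient.mkₐ ℚ (Ink n k)).toLinearMap
        (homogeneousSubmodule (Fin n) ℚ d))
      = Nat.card {f : Fin n → Fin k // Function.Surjective f ∧ opCoinv n k f = d} := by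
  rw [map_homogeneousSubmodule_eq_span hkn,
    finrank_span_eq_card (linearIndependent_mk_expMonomial hkn d), Fintype.card_coe,
    card_stairs_filter]
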